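/- There is an absolute constant C > 0 such that for every d ∈ ℕ, every n ∈ ℕ and every function f : {-1,1}^n → ℝ of degree at most d, one has (∑_{S ⊆ [n], |S| ≤ d} |f̂(S)|^{2d/(d+1)})^{(d+1)/(2d)} ≤ C^{√(d·log d)} · ‖f‖_∞. -/

import Mathlib

open Finset

/-- The Walsh character `χ_S(x) = ∏_{k ∈ S} x_k` on the Boolean cube `{-1,1}^n`,
where a point of the cube is encoded as `x : Fin n → Bool` (`true ↦ 1`, `false ↦ -1`). -/
noncomputable def walsh {n : ℕ} (S : Finset (Fin n)) (x : Fin n → Bool) : ℝ :=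
  ∏ k ∈ S, (if x k then (1 : ℝ) else -1)

/-- The Fourier–Walsh coefficient `f̂(S) = 2^{-n} ∑_x f(x) χ_S(x)`. -/
noncomputable def walshCoeff {n : ℕ} (f : (Fin n → Bool) → ℝ) (S : Finset (Fin n)) : ℝ :=
  (∑ x : Fin n → Bool, f x * walsh S x) / 2 ^ n

/-- The sup norm `‖f‖_∞ = max_x |f(x)|` on the Boolean cube. -/
noncomputable def supNorm {n : ℕ} (f : (Fin n → Bool) → ℝ) : ℝ :=
  ⨆ x : Fin n → Bool, |f x|

theorem sum_powersetCard_succ_erase {α : Type*} [Fintype α] [DecidableEq α] (k : ℕ)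
    (φ : Finset α → α → ℝ) :
    ∑ R ∈ powersetCard (k + 1) univ, ∑ y ∈ R, φ (R.erase y) y =
      ∑ T ∈ powersetCard k univ, ∑ y ∈ Tᶜ, φ T y := by
  rw [sum_sigma', sum_sigma']
  refine sum_bij' (fun p _ => ⟨p.1.erase p.2, p.2⟩) (fun p _ => ⟨insert p.2 p.1, p.2⟩)
    ?_ ?_ ?_ ?_ ?_
  · rintro ⟨R, y⟩ h
    simp only [mem_sigma, mem_powersetCard_univ, mem_compl] at h ⊢
    exact ⟨by rw [card_erase_of_mem h.2, h.1]; rfl, notMem_erase _ _⟩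
  · rintro ⟨T, y⟩ h
    simp only [mem_sigma, mem_powersetCard_univ, mem_compl] at h ⊢
    exact ⟨by rw [card_insert_of_notMem h.2, h.1], mem_insert_self _ _⟩
  · rintro ⟨R, y⟩ h
    simp only [mem_sigma] at h
    simp [insert_erase h.2]
  · rintro ⟨T, y⟩ h
    simp only [mem_sigma, mem_compl] at h
    simp [erase_insert h.2]
  · rintro ⟨R, y⟩ h
    rfl

theorem sum_powersetCard_succ_insert {α : Type*} [Fintype α] [DecidableEq α] (k : ℕ)
    (G : Finset α → ℝ) :
    ∑ T ∈ powersetCard k univ, ∑ y ∈ Tᶜ, G (insert y T) =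
      (k + 1) * ∑ R ∈ powersetCard (k + 1) univ, G R := by
  rw [← sum_powersetCard_succ_erase k (fun T y => G (insert y T)), mul_sum]
  refine sum_congr rfl fun R hR => ?_
  rw [mem_powersetCard_univ] at hR
  rw [sum_congr rfl fun y hy => by rw [insert_erase hy], sum_const, hR]
  simp

/-- A Loomis–Whitney inequality for functions of `k`-element sets. -/
theorem sum_prod_erase_rpow_le {α : Type*} [Fintype α] [DecidableEq α] (k : ℕ) (hk : 1 ≤ k)
    (G : Finset α → ℝ) (hG : ∀ T, 0 ≤ G T) :
    ∑ R ∈ powersetCard (k + 1) univ, ∏ x ∈ R, G (R.erase x) ^ (1 / k : ℝ) ≤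
      (∑ T ∈ powersetCard k univ, G T) ^ ((k + 1) / k : ℝ) := by
  induction k, hk using Nat.le_induction generalizing G with
  | base =>
    have h1 : ∀ R ∈ powersetCard (1 + 1) (univ : Finset α),
        ∏ x ∈ R, G (R.erase x) ^ (1 / (1 : ℕ) : ℝ) = ∏ x ∈ R, G {x} := by
      intro R hR
      rw [mem_powersetCard_univ] at hR
      obtain ⟨x, y, hxy, rfl⟩ := card_eq_two.mp hR
      rw [prod_pair hxy, prod_pair hxy]
      have e1 : ({x, y} : Finset α).erase x = {y} := by
        ext z; simp only [mem_erase, mem_insert, mem_singleton]; grind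
      have e2 : ({x, y} : Finset α).erase y = {x} := by
        ext z; simp only [mem_erase, mem_insert, mem_singleton]; grind
      rw [e1, e2]; simp [mul_comm]
    rw [sum_congr rfl h1]
    have h2 := sum_powersetCard_succ_insert 1 (fun R : Finset α => ∏ x ∈ R, G {x})
    have h3 : ∑ T ∈ powersetCard 1 (univ : Finset α), ∑ y ∈ Tᶜ, ∏ x ∈ insert y T, G {x} ≤
        (∑ T ∈ powersetCard 1 (univ : Finset α), G T) ^ 2 := by
      rw [powersetCard_one, sum_map, sum_map, sq, sum_mul_sum]
      refine sum_le_sum fun x _ => ?_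
      simp only [Function.Embedding.coeFn_mk]
      calc _ = ∑ y ∈ {x}ᶜ, G {x} * G {y} := sum_congr rfl fun y hy => by
            rw [mem_compl, mem_singleton] at hy
            rw [prod_pair hy, mul_comm]
        _ ≤ _ := sum_le_sum_of_subset_of_nonneg (subset_univ _)
            fun _ _ _ => mul_nonneg (hG _) (hG _)
    have h4 : 0 ≤ ∑ R ∈ powersetCard (1 + 1) (univ : Finset α), ∏ x ∈ R, G {x} :=
      sum_nonneg fun _ _ => prod_nonneg fun _ _ => hG _
    have e : (((1 : ℕ) : ℝ) + 1) / ((1 : ℕ) : ℝ) = (2 : ℕ) := by norm_num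
    rw [e, Real.rpow_natCast]
    push_cast at h2
    linarith
  | succ j hj ih =>
    set k : ℕ := j + 1 with hkdef
    have hjpos : (0 : ℝ) < j := by exact_mod_cast hj
    have hkj : (k : ℝ) = j + 1 := by rw [hkdef]; push_cast; ring
    have hkpos : (0 : ℝ) < k := by rw [hkj]; linarith
    set S := ∑ T ∈ powersetCard k univ, G T with hS
    have hS0 : 0 ≤ S := sum_nonneg fun _ _ => hG _
    set H : α → Finset α → ℝ := fun y Q => if y ∈ Q then 0 else G (insert y Q) with hH
    have hH0 : ∀ y Q, 0 ≤ H y Q := by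
      intro y Q; simp only [hH]; split_ifs
      · exact le_rfl
      · exact hG _
    -- the double counting of pairs `y ∈ R`
    have hcount : ((k : ℝ) + 1) * ∑ R ∈ powersetCard (k + 1) univ,
        ∏ x ∈ R, G (R.erase x) ^ (1 / k : ℝ) =
        ∑ y, ∑ T ∈ (powersetCard k univ).filter (fun T => y ∉ T),
          G T ^ (1 / k : ℝ) * ∏ x ∈ T, H y (T.erase x) ^ (1 / k : ℝ) := by
      rw [← sum_powersetCard_succ_insert k]
      simp_rw [sum_filter]
      rw [sum_comm]
      refine sum_congr rfl fun T _ => ?_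
      rw [← sum_filter]
      refine sum_congr (by ext; simp) fun y hy => ?_
      have hy' : y ∉ T := by simpa using hy
      rw [prod_insert hy', erase_insert hy']
      congr 1
      refine prod_congr rfl fun x hx => ?_
      have hxy : y ≠ x := fun h => hy' (h ▸ hx)
      rw [erase_insert_of_ne hxy]
      simp [hH, hy']
    have hbound : ∀ y, ∑ T ∈ (powersetCard k univ).filter (fun T => y ∉ T),
          G T ^ (1 / k : ℝ) * ∏ x ∈ T, H y (T.erase x) ^ (1 / k : ℝ) ≤
          S ^ (1 / k : ℝ) * ∑ Q ∈ powersetCard j univ, H y Q := by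
      intro y
      have hpq : (k : ℝ).HolderConjugate (k / j : ℝ) := by
        rw [Real.holderConjugate_iff]
        refine ⟨by rw [hkj]; linarith, ?_⟩
        rw [hkj]; field_simp; ring
      calc _ ≤ ∑ T ∈ powersetCard k univ,
            G T ^ (1 / k : ℝ) * ∏ x ∈ T, H y (T.erase x) ^ (1 / k : ℝ) :=
            sum_le_sum_of_subset_of_nonneg (filter_subset _ _) fun _ _ _ =>
              mul_nonneg (Real.rpow_nonneg (hG _) _)
                (prod_nonneg fun _ _ => Real.rpow_nonneg (hH0 _ _) _)
        _ ≤ (∑ T ∈ powersetCard k univ, (G T ^ (1 / k : ℝ)) ^ (k : ℝ)) ^ (1 / k : ℝ) *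
            (∑ T ∈ powersetCard k univ,
              (∏ x ∈ T, H y (T.erase x) ^ (1 / k : ℝ)) ^ (k / j : ℝ)) ^ (1 / (k / j : ℝ)) :=
            Real.inner_le_Lp_mul_Lq_of_nonneg _ hpq (fun _ _ => Real.rpow_nonneg (hG _) _)
              (fun _ _ => prod_nonneg fun _ _ => Real.rpow_nonneg (hH0 _ _) _)
        _ = S ^ (1 / k : ℝ) * (∑ T ∈ powersetCard k univ,
              ∏ x ∈ T, H y (T.erase x) ^ (1 / j : ℝ)) ^ (j / k : ℝ) := by
            congr 2
            · refine sum_congr rfl fun T _ => ?_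
              rw [← Real.rpow_mul (hG _), one_div_mul_cancel hkpos.ne', Real.rpow_one]
            · refine sum_congr rfl fun T _ => ?_
              rw [← Real.finsetProd_rpow _ _ fun _ _ => Real.rpow_nonneg (hH0 _ _) _]
              refine prod_congr rfl fun x _ => ?_
              rw [← Real.rpow_mul (hH0 _ _)]
              congr 1
              field_simp
            · field_simp
        _ ≤ S ^ (1 / k : ℝ) *
            ((∑ Q ∈ powersetCard j univ, H y Q) ^ ((j + 1) / j : ℝ)) ^ (j / k : ℝ) := by
            refine mul_le_mul_of_nonneg_left ?_ (Real.rpow_nonneg hS0 _)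
            exact Real.rpow_le_rpow (sum_nonneg fun _ _ => prod_nonneg fun _ _ =>
              Real.rpow_nonneg (hH0 _ _) _) (ih (H y) (hH0 y)) (by positivity)
        _ = _ := by
            rw [← Real.rpow_mul (sum_nonneg fun _ _ => hH0 _ _), ← hkj,
              div_mul_div_cancel₀ hjpos.ne', div_self hkpos.ne', Real.rpow_one]
    have hdeg : ∑ y, ∑ Q ∈ powersetCard j univ, H y Q = k * S := by
      rw [hkj, hS, ← sum_powersetCard_succ_insert j G, sum_comm]
      refine sum_congr rfl fun Q _ => ?_
      simp only [hH]
      rw [sum_ite, sum_const_zero, zero_add]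
      exact sum_congr (by ext; simp) fun _ _ => rfl
    have key : ((k : ℝ) + 1) * ∑ R ∈ powersetCard (k + 1) univ,
        ∏ x ∈ R, G (R.erase x) ^ (1 / k : ℝ) ≤ (k + 1) * S ^ ((k + 1) / k : ℝ) := by
      rw [hcount]
      refine (sum_le_sum fun y _ => hbound y).trans ?_
      rw [← mul_sum, hdeg]
      have e : S ^ (1 / k : ℝ) * (k * S) = k * S ^ ((k + 1) / k : ℝ) := by
        have : ((k + 1) / k : ℝ) = 1 / k + 1 := by field_simp; ring
        rw [this, Real.rpow_add_one' hS0 (by positivity)]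
        ring
      rw [e]
      have := Real.rpow_nonneg hS0 ((k + 1) / k : ℝ)
      linarith
    exact le_of_mul_le_mul_left key (by positivity)

/-- One step of a Blei-type inequality for set functions. -/
theorem blei_step {α : Type*} [Fintype α] [DecidableEq α] (k : ℕ) (hk : 1 ≤ k)
    (u v : Finset α → ℝ) (hu : ∀ R, 0 ≤ u R) (hv : ∀ T, 0 ≤ v T)
    (huv : ∀ T ∈ powersetCard k univ, ∑ y ∈ Tᶜ, u (insert y T) = (k + 1) * v T) :
    (∑ R ∈ powersetCard (k + 1) univ, u R ^ ((k + 1) / (k + 2) : ℝ)) ^ ((k + 2) / (k + 1) : ℝ) ≤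
      (∑ T ∈ powersetCard k univ, v T ^ (k / (k + 1) : ℝ)) ^ ((k + 1) / k : ℝ) := by
  have hk0 : (0 : ℝ) < k := by exact_mod_cast hk
  set M := ∑ T ∈ powersetCard k univ, v T ^ (k / (k + 1) : ℝ) with hM
  have hM0 : 0 ≤ M := sum_nonneg fun _ _ => Real.rpow_nonneg (hv _) _
  set Y : Finset α → ℝ := fun R => ∏ x ∈ R, v (R.erase x) ^ (1 / (k + 1) : ℝ) with hY
  have hY0 : ∀ R, 0 ≤ Y R := fun R => prod_nonneg fun _ _ => Real.rpow_nonneg (hv _) _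
  set X : Finset α → ℝ := fun R => Y R ^ (-(1 / (k + 1)) : ℝ) with hX
  have hX0 : ∀ R, 0 ≤ X R := fun R => Real.rpow_nonneg (hY0 _) _
  have hsplit : ∀ R ∈ powersetCard (k + 1) univ, u R ^ ((k + 1) / (k + 2) : ℝ) =
      (u R * X R) ^ ((k + 1) / (k + 2) : ℝ) * Y R ^ (1 / (k + 2) : ℝ) := by
    intro R hR
    rw [mem_powersetCard_univ] at hR
    rcases (hu R).eq_or_lt with h0 | hpos
    · rw [← h0, zero_mul, Real.zero_rpow (by positivity), zero_mul]
    have hYpos : 0 < Y R := by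
      refine prod_pos fun x hx => Real.rpow_pos_of_pos ?_ _
      have h1 := huv (R.erase x) (by
        rw [mem_powersetCard_univ, card_erase_of_mem hx, hR]; rfl)
      have h2 : u R ≤ ∑ y ∈ (R.erase x)ᶜ, u (insert y (R.erase x)) := by
        have := single_le_sum (f := fun y => u (insert y (R.erase x))) (s := (R.erase x)ᶜ)
          (fun _ _ => hu _) (show x ∈ (R.erase x)ᶜ by simp)
        simpa [insert_erase hx] using this
      by_contra hneg
      have : v (R.erase x) = 0 := le_antisymm (not_lt.mp hneg) (hv _)
      rw [this, mul_zero] at h1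
      linarith
    rw [Real.mul_rpow (hu R) (hX0 R), mul_assoc, hX, ← Real.rpow_mul (hY0 R),
      ← Real.rpow_add hYpos]
    have e : (-(1 / (k + 1)) * ((k + 1) / (k + 2)) + 1 / (k + 2) : ℝ) = 0 := by
      field_simp; ring
    rw [e, Real.rpow_zero, mul_one]
  have hXle : ∑ R ∈ powersetCard (k + 1) univ, u R * X R ≤ M := by
    have h1 : ∀ R ∈ powersetCard (k + 1) univ, u R * X R ≤
        ∑ y ∈ R, u (insert y (R.erase y)) *
          ((1 / (k + 1) : ℝ) * v (R.erase y) ^ (-(1 / (k + 1)) : ℝ)) := by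
      intro R hR
      rw [mem_powersetCard_univ] at hR
      rw [sum_congr rfl fun y hy => by rw [insert_erase hy], ← mul_sum]
      refine mul_le_mul_of_nonneg_left ?_ (hu R)
      have := Real.geom_mean_le_arith_mean_weighted R (fun _ => (1 / (k + 1) : ℝ))
        (fun y => v (R.erase y) ^ (-(1 / (k + 1)) : ℝ)) (fun _ _ => by positivity)
        (by rw [sum_const, hR, nsmul_eq_mul]; push_cast; field_simp)
        (fun _ _ => Real.rpow_nonneg (hv _) _)
      refine le_of_eq_of_le ?_ this
      simp only [hX, hY]
      rw [← Real.finsetProd_rpow _ _ fun _ _ => Real.rpow_nonneg (hv _) _]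
      refine prod_congr rfl fun y _ => ?_
      rw [← Real.rpow_mul (hv _), ← Real.rpow_mul (hv _), mul_comm]
    refine (sum_le_sum h1).trans (le_of_eq ?_)
    rw [sum_powersetCard_succ_erase k (fun T y => u (insert y T) *
          ((1 / (k + 1) : ℝ) * v T ^ (-(1 / (k + 1)) : ℝ)))]
    refine sum_congr rfl fun T hT => ?_
    rw [← sum_mul, huv T hT]
    rcases (hv T).eq_or_lt with h0 | hpos
    · rw [← h0, mul_zero, zero_mul, Real.zero_rpow (by positivity)]
    · have e : (k / (k + 1) : ℝ) = 1 + -(1 / (k + 1)) := by field_simp; ring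
      rw [e, Real.rpow_add hpos, Real.rpow_one]
      field_simp
  have hYle : ∑ R ∈ powersetCard (k + 1) univ, Y R ≤ M ^ ((k + 1) / k : ℝ) := by
    refine le_of_eq_of_le ?_ (sum_prod_erase_rpow_le k hk (fun T => v T ^ (k / (k + 1) : ℝ))
      fun T => Real.rpow_nonneg (hv _) _)
    refine sum_congr rfl fun R _ => prod_congr rfl fun x _ => ?_
    rw [← Real.rpow_mul (hv _)]
    congr 1
    field_simp
  have hpq : ((k + 2) / (k + 1) : ℝ).HolderConjugate (k + 2 : ℝ) := by
    rw [Real.holderConjugate_iff]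
    refine ⟨by rw [lt_div_iff₀ (by positivity)]; linarith, ?_⟩
    field_simp; ring
  have hmain : ∑ R ∈ powersetCard (k + 1) univ, u R ^ ((k + 1) / (k + 2) : ℝ) ≤
      M ^ ((k + 1) / (k + 2) : ℝ) * (M ^ ((k + 1) / k : ℝ)) ^ (1 / (k + 2) : ℝ) := by
    rw [sum_congr rfl hsplit]
    refine (Real.inner_le_Lp_mul_Lq_of_nonneg _ hpq
      (fun R _ => Real.rpow_nonneg (mul_nonneg (hu R) (hX0 R)) _)
      (fun R _ => Real.rpow_nonneg (hY0 R) _)).trans ?_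
    have e1 : ∀ R, ((u R * X R) ^ ((k + 1) / (k + 2) : ℝ)) ^ ((k + 2) / (k + 1) : ℝ) =
        u R * X R := by
      intro R
      rw [← Real.rpow_mul (mul_nonneg (hu R) (hX0 R)), div_mul_div_cancel₀ (by positivity),
        div_self (by positivity), Real.rpow_one]
    have e2 : ∀ R, (Y R ^ (1 / (k + 2) : ℝ)) ^ (k + 2 : ℝ) = Y R := by
      intro R
      rw [← Real.rpow_mul (hY0 R), one_div_mul_cancel (by positivity), Real.rpow_one]
    simp_rw [e1, e2]
    rw [one_div_div]
    exact mul_le_mul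
      (Real.rpow_le_rpow (sum_nonneg fun R _ => mul_nonneg (hu R) (hX0 R)) hXle (by positivity))
      (Real.rpow_le_rpow (sum_nonneg fun R _ => hY0 R) hYle (by positivity))
      (Real.rpow_nonneg (sum_nonneg fun R _ => hY0 R) _) (Real.rpow_nonneg hM0 _)
  refine (Real.rpow_le_rpow (sum_nonneg fun R _ => Real.rpow_nonneg (hu R) _) hmain
    (by positivity)).trans (le_of_eq ?_)
  rw [← Real.rpow_mul hM0, ← Real.rpow_add_of_nonneg hM0 (by positivity) (by positivity),
    ← Real.rpow_mul hM0]
  congr 1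
  field_simp

/-- A Blei-type inequality: the `ℓ_{m/(m+1)}` quasi-norm of a function of `m`-sets is bounded by
the mixed quasi-norm obtained by summing first over the `m`-sets containing a given `k`-set. -/
theorem blei {α : Type*} [Fintype α] [DecidableEq α] (k m : ℕ) (hk : 1 ≤ k) (hkm : k ≤ m)
    (u : Finset α → ℝ) (hu : ∀ R, 0 ≤ u R) :
    (∑ S ∈ powersetCard m univ, u S ^ (m / (m + 1) : ℝ)) ^ ((m + 1) / m : ℝ) ≤
      (∑ T ∈ powersetCard k univ,
        (∑ S ∈ (powersetCard m univ).filter (T ⊆ ·), u S) ^ (k / (k + 1) : ℝ)) ^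
          ((k + 1) / k : ℝ) := by
  set v : ℕ → Finset α → ℝ := fun j T =>
    (∑ S ∈ (powersetCard m univ).filter (T ⊆ ·), u S) / m.choose j with hvdef
  have hv0 : ∀ j T, 0 ≤ v j T := fun j T =>
    div_nonneg (sum_nonneg fun _ _ => hu _) (by positivity)
  have hstep : ∀ j, j + 1 ≤ m → ∀ T ∈ powersetCard j (univ : Finset α),
      ∑ y ∈ Tᶜ, v (j + 1) (insert y T) = (j + 1) * v j T := by
    intro j hj T hT
    rw [mem_powersetCard_univ] at hT
    have h1 : ∑ y ∈ Tᶜ, ∑ S ∈ (powersetCard m univ).filter (insert y T ⊆ ·), u S =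
        (m - j : ℝ) * ∑ S ∈ (powersetCard m univ).filter (T ⊆ ·), u S := by
      simp_rw [sum_filter]
      rw [sum_comm, mul_sum]
      refine sum_congr rfl fun S hS => ?_
      rw [mem_powersetCard_univ] at hS
      by_cases hTS : T ⊆ S
      · rw [if_pos hTS, ← sum_filter]
        have : Tᶜ.filter (fun y => insert y T ⊆ S) = S \ T := by
          ext y; simp only [mem_filter, mem_compl, insert_subset_iff, mem_sdiff]; tauto
        rw [this, sum_const, card_sdiff_of_subset hTS, hS, hT, nsmul_eq_mul,
          Nat.cast_sub (by omega)]
      · rw [if_neg hTS, mul_zero]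
        refine sum_eq_zero fun y _ => if_neg fun h => hTS ((subset_insert _ _).trans h)
    simp only [hvdef]
    rw [← sum_div, h1]
    have hc := Nat.choose_succ_right_eq m j
    have hc' : (m.choose (j + 1) : ℝ) * (j + 1) = m.choose j * (m - j) := by
      have := congrArg (Nat.cast : ℕ → ℝ) hc
      rw [Nat.cast_mul, Nat.cast_mul, Nat.cast_sub (by omega)] at this
      exact_mod_cast this
    have p1 : (0 : ℝ) < m.choose (j + 1) := by exact_mod_cast Nat.choose_pos hj
    have p2 : (0 : ℝ) < m.choose j := by exact_mod_cast Nat.choose_pos (by omega)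
    rw [mul_div_assoc', div_eq_div_iff p1.ne' p2.ne']
    linear_combination -(∑ S ∈ (powersetCard m univ).filter (T ⊆ ·), u S) * hc'
  have hchain : ∀ j, k ≤ j → j ≤ m →
      (∑ T ∈ powersetCard j univ, v j T ^ (j / (j + 1) : ℝ)) ^ ((j + 1) / j : ℝ) ≤
      (∑ T ∈ powersetCard k univ, v k T ^ (k / (k + 1) : ℝ)) ^ ((k + 1) / k : ℝ) := by
    intro j hj
    induction j, hj using Nat.le_induction with
    | base => intro _; exact le_rfl
    | succ j hj ih =>
      intro hjm
      refine le_trans ?_ (ih (by omega))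
      have := blei_step j (hk.trans hj) (v (j + 1)) (v j) (hv0 _) (hv0 _) (hstep j hjm)
      push_cast
      have e : (j : ℝ) + 1 + 1 = j + 2 := by ring
      rw [e]
      exact this
  have hm := hchain m hkm le_rfl
  have e : ∀ S ∈ powersetCard m (univ : Finset α), v m S = u S := by
    intro S hS
    have : (powersetCard m (univ : Finset α)).filter (S ⊆ ·) = {S} := by
      ext S'
      simp only [mem_filter, mem_powersetCard_univ, mem_singleton] at hS ⊢
      constructor
      · rintro ⟨h1, h2⟩
        exact (eq_of_subset_of_card_le h2 (by omega)).symm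
      · rintro rfl
        exact ⟨hS, subset_rfl⟩
    simp [hvdef, this]
  rw [sum_congr rfl fun S hS => by rw [e S hS]] at hm
  refine hm.trans ?_
  refine Real.rpow_le_rpow (sum_nonneg fun _ _ => Real.rpow_nonneg (hv0 _ _) _) ?_ (by positivity)
  refine sum_le_sum fun T _ => Real.rpow_le_rpow (hv0 _ _) ?_ (by positivity)
  refine div_le_self (sum_nonneg fun _ _ => hu _) ?_
  exact_mod_cast Nat.choose_pos hkm

/-- The mean of a function over the discrete cube. -/
noncomputable def cubeMean {α : Type*} [Fintype α] [DecidableEq α] (g : (α → Bool) → ℝ) : ℝ :=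
  (∑ x, g x) / 2 ^ Fintype.card α

/-- The point of `{-1, 1}^α` encoded by a Boolean vector. -/
noncomputable def cubeSign {α : Type*} (x : α → Bool) (i : α) : ℝ := if x i then 1 else -1

theorem cubeSign_sq {α : Type*} (x : α → Bool) (i : α) : cubeSign x i ^ 2 = 1 := by
  unfold cubeSign; split_ifs <;> norm_num

theorem abs_cubeSign {α : Type*} (x : α → Bool) (i : α) : |cubeSign x i| = 1 := by
  unfold cubeSign; split_ifs <;> norm_num

section CubeMean

variable {α : Type*} [Fintype α] [DecidableEq α]

theorem cubeMean_mono {f g : (α → Bool) → ℝ} (h : ∀ x, f x ≤ g x) : cubeMean f ≤ cubeMean g :=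
  div_le_div_of_nonneg_right (sum_le_sum fun x _ => h x) (by positivity)

theorem cubeMean_nonneg {f : (α → Bool) → ℝ} (h : ∀ x, 0 ≤ f x) : 0 ≤ cubeMean f :=
  div_nonneg (sum_nonneg fun x _ => h x) (by positivity)

theorem cubeMean_const (c : ℝ) : cubeMean (fun _ : α → Bool => c) = c := by
  simp [cubeMean]

theorem cubeMean_add (f g : (α → Bool) → ℝ) :
    cubeMean (fun x => f x + g x) = cubeMean f + cubeMean g := by
  simp [cubeMean, sum_add_distrib, add_div]

theorem cubeMean_const_mul (c : ℝ) (f : (α → Bool) → ℝ) :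
    cubeMean (fun x => c * f x) = c * cubeMean f := by
  simp [cubeMean, ← mul_sum, mul_div_assoc]

theorem cubeMean_sum {ι : Type*} (s : Finset ι) (f : ι → (α → Bool) → ℝ) :
    cubeMean (fun x => ∑ i ∈ s, f i x) = ∑ i ∈ s, cubeMean (f i) := by
  simp only [cubeMean]
  rw [sum_comm, sum_div]

theorem cubeMean_update_not (v : α) (f : (α → Bool) → ℝ) :
    cubeMean (fun x => f (Function.update x v (!x v))) = cubeMean f := by
  have hinv : Function.Involutive fun x : α → Bool => Function.update x v (!x v) := by
    intro x; simp
  unfold cubeMean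
  rw [← Equiv.sum_comp hinv.toPerm f]
  rfl

theorem cubeMean_mul_sq_le (f g : (α → Bool) → ℝ) :
    cubeMean (fun x => f x * g x) ^ 2 ≤
      cubeMean (fun x => f x ^ 2) * cubeMean (fun x => g x ^ 2) := by
  simp only [cubeMean]
  rw [div_pow, div_mul_div_comm, ← sq]
  exact div_le_div_of_nonneg_right (sum_mul_sq_le_sq_mul_sq _ _ _) (by positivity)

end CubeMean

section Bonami

variable {α : Type*} [DecidableEq α]

/-- A Walsh polynomial supported in `insert v V` splits into its parts independent of `v`. -/
theorem walsh_sum_insert {v : α} {V : Finset α} (hv : v ∉ V) (b : Finset α → ℝ) (x : α → Bool) :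
    ∑ S ∈ (insert v V).powerset, b S * ∏ i ∈ S, cubeSign x i =
      (∑ S ∈ V.powerset, b S * ∏ i ∈ S, cubeSign x i) +
        cubeSign x v * ∑ S ∈ V.powerset, b (insert v S) * ∏ i ∈ S, cubeSign x i := by
  rw [sum_powerset_insert hv, mul_sum]
  congr 1
  refine sum_congr rfl fun S hS => ?_
  rw [prod_insert fun h => hv (mem_powerset.mp hS h)]
  ring

theorem walsh_sum_update {v : α} {V : Finset α} (hv : v ∉ V) (b : Finset α → ℝ) (x : α → Bool)
    (c : Bool) :
    ∑ S ∈ V.powerset, b S * ∏ i ∈ S, cubeSign (Function.update x v c) i =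
      ∑ S ∈ V.powerset, b S * ∏ i ∈ S, cubeSign x i := by
  refine sum_congr rfl fun S hS => ?_
  congr 1
  refine prod_congr rfl fun i hi => ?_
  have : i ≠ v := fun h => hv (h ▸ mem_powerset.mp hS hi)
  simp [cubeSign, this]

theorem cubeSign_update_not (x : α → Bool) (v : α) :
    cubeSign (Function.update x v (!x v)) v = -cubeSign x v := by
  cases h : x v <;> simp [cubeSign, h]

theorem sum_powerset_insert_mul_sq {v : α} {V : Finset α} (hv : v ∉ V) (c : ℝ)
    (b : Finset α → ℝ) :
    ∑ S ∈ (insert v V).powerset, c ^ #S * b S ^ 2 =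
      (∑ S ∈ V.powerset, c ^ #S * b S ^ 2) +
        c * ∑ S ∈ V.powerset, c ^ #S * b (insert v S) ^ 2 := by
  rw [sum_powerset_insert hv, mul_sum]
  congr 1
  refine sum_congr rfl fun S hS => ?_
  rw [card_insert_of_notMem fun h => hv (mem_powerset.mp hS h)]
  ring

variable [Fintype α]

theorem cubeMean_walsh_sum_sq (V : Finset α) (b : Finset α → ℝ) :
    cubeMean (fun x => (∑ S ∈ V.powerset, b S * ∏ i ∈ S, cubeSign x i) ^ 2) =
      ∑ S ∈ V.powerset, b S ^ 2 := by
  induction V using Finset.induction_on generalizing b with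
  | empty => simp [cubeMean_const]
  | insert v V hv ih =>
    simp_rw [walsh_sum_insert hv]
    set g : (α → Bool) → ℝ := fun x => ∑ S ∈ V.powerset, b S * ∏ i ∈ S, cubeSign x i with hg
    set h : (α → Bool) → ℝ := fun x => ∑ S ∈ V.powerset, b (insert v S) * ∏ i ∈ S, cubeSign x i
      with hh
    have hflip := cubeMean_update_not v (fun x => (g x + cubeSign x v * h x) ^ 2)
    have hsum := cubeMean_add (fun x => (g x + cubeSign x v * h x) ^ 2)
      (fun x => (g (Function.update x v (!x v)) + cubeSign (Function.update x v (!x v)) v *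
        h (Function.update x v (!x v))) ^ 2)
    have hexp : ∀ x, (g x + cubeSign x v * h x) ^ 2 + (g (Function.update x v (!x v)) +
        cubeSign (Function.update x v (!x v)) v * h (Function.update x v (!x v))) ^ 2 =
        2 * (g x ^ 2 + h x ^ 2) := by
      intro x
      have e1 : g (Function.update x v (!x v)) = g x := walsh_sum_update hv _ _ _
      have e2 : h (Function.update x v (!x v)) = h x :=
        walsh_sum_update hv (fun S => b (insert v S)) _ _
      rw [e1, e2, cubeSign_update_not]
      linear_combination 2 * h x ^ 2 * cubeSign_sq x v
    simp_rw [hexp] at hsum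
    rw [cubeMean_const_mul, cubeMean_add, hflip] at hsum
    have ihg := ih b
    have ihh := ih fun S => b (insert v S)
    rw [sum_powerset_insert hv]
    linarith

/-- The Bonami lemma. -/
theorem cubeMean_walsh_sum_pow_four_le (V : Finset α) (b : Finset α → ℝ) :
    cubeMean (fun x => (∑ S ∈ V.powerset, b S * ∏ i ∈ S, cubeSign x i) ^ 4) ≤
      (∑ S ∈ V.powerset, 3 ^ #S * b S ^ 2) ^ 2 := by
  induction V using Finset.induction_on generalizing b with
  | empty => simp [cubeMean_const, ← pow_mul]
  | insert v V hv ih =>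
    simp_rw [walsh_sum_insert hv]
    set g : (α → Bool) → ℝ := fun x => ∑ S ∈ V.powerset, b S * ∏ i ∈ S, cubeSign x i with hg
    set h : (α → Bool) → ℝ := fun x => ∑ S ∈ V.powerset, b (insert v S) * ∏ i ∈ S, cubeSign x i
      with hh
    have hflip := cubeMean_update_not v (fun x => (g x + cubeSign x v * h x) ^ 4)
    have hsum := cubeMean_add (fun x => (g x + cubeSign x v * h x) ^ 4)
      (fun x => (g (Function.update x v (!x v)) + cubeSign (Function.update x v (!x v)) v *
        h (Function.update x v (!x v))) ^ 4)
    have hexp : ∀ x, (g x + cubeSign x v * h x) ^ 4 + (g (Function.update x v (!x v)) +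
        cubeSign (Function.update x v (!x v)) v * h (Function.update x v (!x v))) ^ 4 =
        2 * (g x ^ 4 + (6 * (g x ^ 2 * h x ^ 2) + h x ^ 4)) := by
      intro x
      have e1 : g (Function.update x v (!x v)) = g x := walsh_sum_update hv _ _ _
      have e2 : h (Function.update x v (!x v)) = h x :=
        walsh_sum_update hv (fun S => b (insert v S)) _ _
      rw [e1, e2, cubeSign_update_not]
      linear_combination (12 * g x ^ 2 * h x ^ 2 + 2 * h x ^ 4 * (cubeSign x v ^ 2 + 1)) *
        cubeSign_sq x v
    simp_rw [hexp] at hsum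
    rw [cubeMean_const_mul, cubeMean_add, cubeMean_add, cubeMean_const_mul, hflip] at hsum
    have ihg := ih b
    have ihh := ih fun S => b (insert v S)
    have hcs := cubeMean_mul_sq_le (fun x => g x ^ 2) (fun x => h x ^ 2)
    simp_rw [← pow_mul] at hcs
    norm_num only at hcs
    rw [sum_powerset_insert_mul_sq hv]
    set G := ∑ S ∈ V.powerset, 3 ^ #S * b S ^ 2
    set H := ∑ S ∈ V.powerset, 3 ^ #S * b (insert v S) ^ 2
    have hG : 0 ≤ G := sum_nonneg fun _ _ => by positivity
    have hH : 0 ≤ H := sum_nonneg fun _ _ => by positivity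
    have h4 : cubeMean (fun x => g x ^ 2 * h x ^ 2) ≤ G * H := by
      refine abs_le_of_sq_le_sq' ?_ (mul_nonneg hG hH) |>.2
      rw [mul_pow]
      exact hcs.trans (mul_le_mul ihg ihh (cubeMean_nonneg fun _ => by positivity) (sq_nonneg _))
    nlinarith [sq_nonneg H]

/-- The multi-affine polynomial with coefficients `a`. -/
noncomputable def multiaffine (a : Finset α → ℝ) (z : α → ℝ) : ℝ := ∑ S, a S * ∏ i ∈ S, z i

theorem cubeMean_multiaffine_sq (b : Finset α → ℝ) :
    cubeMean (fun x => multiaffine b (cubeSign x) ^ 2) = ∑ S, b S ^ 2 := by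
  simpa [multiaffine] using cubeMean_walsh_sum_sq univ b

theorem cubeMean_multiaffine_pow_four_le (d : ℕ) (b : Finset α → ℝ) (hb : ∀ S, d < #S → b S = 0) :
    cubeMean (fun x => multiaffine b (cubeSign x) ^ 4) ≤
      9 ^ d * cubeMean (fun x => multiaffine b (cubeSign x) ^ 2) ^ 2 := by
  have h := cubeMean_walsh_sum_pow_four_le univ b
  simp only [powerset_univ] at h
  refine h.trans ?_
  have e : (9 : ℝ) ^ d = (3 ^ d) ^ 2 := by rw [← pow_mul, mul_comm, pow_mul]; norm_num
  rw [cubeMean_multiaffine_sq, e, ← mul_pow]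
  refine pow_le_pow_left₀ (sum_nonneg fun _ _ => by positivity) ?_ 2
  rw [mul_sum]
  refine sum_le_sum fun S _ => ?_
  by_cases hS : d < #S
  · simp [hb S hS]
  · exact mul_le_mul_of_nonneg_right (pow_le_pow_right₀ (by norm_num) (not_lt.mp hS)) (sq_nonneg _)

end Bonami

/-- Comparison of the `L²` and `L^{2k/(k+1)}` norms under a hypercontractive `L⁴` bound. -/
theorem cubeMean_sq_rpow_le {α : Type*} [Fintype α] [DecidableEq α] (k : ℕ) (hk : 1 ≤ k)
    (K : ℝ) (hK : 0 ≤ K)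
    (g : (α → Bool) → ℝ)
    (hg : cubeMean (fun x => g x ^ 4) ≤ K * cubeMean (fun x => g x ^ 2) ^ 2) :
    cubeMean (fun x => g x ^ 2) ^ (k / (k + 1) : ℝ) ≤
      K ^ (1 / (k + 1) : ℝ) * cubeMean (fun x => (g x ^ 2) ^ (k / (k + 1) : ℝ)) := by
  set A := cubeMean (fun x => g x ^ 2) with hA
  set P := cubeMean (fun x => (g x ^ 2) ^ (k / (k + 1) : ℝ)) with hP
  have hA0 : 0 ≤ A := cubeMean_nonneg fun _ => sq_nonneg _
  have hP0 : 0 ≤ P := cubeMean_nonneg fun _ => by positivity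
  rcases hA0.eq_or_lt with h0 | hpos
  · have hk0 : (0 : ℝ) < k := by exact_mod_cast hk
    rw [← h0, Real.zero_rpow (by positivity)]
    positivity
  have hpq : ((k + 2) / (k + 1) : ℝ).HolderConjugate (k + 2 : ℝ) := by
    rw [Real.holderConjugate_iff]
    refine ⟨by rw [lt_div_iff₀ (by positivity)]; linarith, ?_⟩
    field_simp; ring
  have hH : A ≤ P ^ ((k + 1) / (k + 2) : ℝ) * cubeMean (fun x => g x ^ 4) ^ (1 / (k + 2) : ℝ) := by
    have h1 := Real.inner_le_Lp_mul_Lq_of_nonneg univ hpq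
      (f := fun x => (g x ^ 2) ^ (k / (k + 2) : ℝ)) (g := fun x => (g x ^ 4) ^ (1 / (k + 2) : ℝ))
      (fun _ _ => by positivity) (fun _ _ => by positivity)
    have e1 : ∀ x, (g x ^ 2) ^ (k / (k + 2) : ℝ) * (g x ^ 4) ^ (1 / (k + 2) : ℝ) = g x ^ 2 := by
      intro x
      have : g x ^ 4 = (g x ^ 2) ^ (2 : ℝ) := by
        rw [Real.rpow_ofNat]; ring
      rw [this, ← Real.rpow_mul (sq_nonneg _),
        ← Real.rpow_add_of_nonneg (sq_nonneg _) (by positivity) (by positivity)]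
      have : (k / (k + 2) + 2 * (1 / (k + 2)) : ℝ) = 1 := by field_simp
      rw [this, Real.rpow_one]
    have e2 : ∀ x, ((g x ^ 2) ^ (k / (k + 2) : ℝ)) ^ ((k + 2) / (k + 1) : ℝ) =
        (g x ^ 2) ^ (k / (k + 1) : ℝ) := by
      intro x
      rw [← Real.rpow_mul (sq_nonneg _), div_mul_div_cancel₀ (by positivity)]
    have e3 : ∀ x, ((g x ^ 4) ^ (1 / (k + 2) : ℝ)) ^ (k + 2 : ℝ) = g x ^ 4 := by
      intro x
      rw [← Real.rpow_mul (by positivity), one_div_mul_cancel (by positivity), Real.rpow_one]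
    simp_rw [e1, e2, e3] at h1
    rw [one_div_div] at h1
    have hN : (0 : ℝ) < 2 ^ Fintype.card α := by positivity
    simp only [hA, hP, cubeMean]
    rw [Real.div_rpow (sum_nonneg fun _ _ => by positivity) hN.le,
      Real.div_rpow (sum_nonneg fun _ _ => by positivity) hN.le, div_mul_div_comm,
      ← Real.rpow_add hN]
    have : ((k + 1) / (k + 2) + 1 / (k + 2) : ℝ) = 1 := by field_simp; ring
    rw [this, Real.rpow_one]
    exact div_le_div_of_nonneg_right h1 hN.le
  have hF0 : 0 ≤ cubeMean (fun x => g x ^ 4) := cubeMean_nonneg fun _ => by positivity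
  have h2 : A ≤ P ^ ((k + 1) / (k + 2) : ℝ) * (K * A ^ 2) ^ (1 / (k + 2) : ℝ) :=
    hH.trans (mul_le_mul_of_nonneg_left (Real.rpow_le_rpow hF0 hg (by positivity)) (by positivity))
  have h3 := Real.rpow_le_rpow hA0 h2 (show (0 : ℝ) ≤ (k + 2) / (k + 1) by positivity)
  have e4 : (P ^ ((k + 1) / (k + 2) : ℝ) * (K * A ^ 2) ^ (1 / (k + 2) : ℝ)) ^
      ((k + 2) / (k + 1) : ℝ) = P * K ^ (1 / (k + 1) : ℝ) * A ^ (2 / (k + 1) : ℝ) := by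
    rw [Real.mul_rpow (by positivity) (by positivity), ← Real.rpow_mul hP0,
      ← Real.rpow_mul (by positivity), div_mul_div_cancel₀ (by positivity),
      div_self (by positivity), Real.rpow_one, div_mul_div_cancel₀ (by positivity),
      Real.mul_rpow hK (by positivity), ← Real.rpow_natCast, ← Real.rpow_mul hA0, mul_assoc]
    congr 3
    push_cast; ring
  rw [e4] at h3
  have e5 : A ^ ((k + 2) / (k + 1) : ℝ) = A ^ (k / (k + 1) : ℝ) * A ^ (2 / (k + 1) : ℝ) := by
    rw [← Real.rpow_add hpos]; congr 1; field_simp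
  rw [e5] at h3
  have := le_of_mul_le_mul_right h3 (Real.rpow_pos_of_pos hpos _)
  linarith

section Derivatives

theorem multiaffine_zero {α : Type*} [Fintype α] (a : Finset α → ℝ) :
    multiaffine a 0 = a ∅ := by
  unfold multiaffine
  rw [sum_eq_single ∅]
  · simp
  · intro S _ hS
    obtain ⟨i, hi⟩ := nonempty_iff_ne_empty.mpr hS
    rw [prod_eq_zero hi (by simp), mul_zero]
  · simp

theorem multiaffine_smul {α : Type*} [Fintype α] (a : Finset α → ℝ) (r : ℝ) (z : α → ℝ) :
    multiaffine a (r • z) = multiaffine (fun S => r ^ #S * a S) z := by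
  refine sum_congr rfl fun S _ => ?_
  simp_rw [Pi.smul_apply, smul_eq_mul]
  rw [prod_mul_distrib, prod_const]
  ring

variable {α : Type*} [DecidableEq α]

/-- The coefficients of the partial derivative `∂_T` of a multi-affine polynomial. -/
noncomputable def derivCoeff (a : Finset α → ℝ) (T S : Finset α) : ℝ :=
  if Disjoint S T then a (S ∪ T) else 0

theorem derivCoeff_eq_zero {d : ℕ} {a : Finset α → ℝ} (ha : ∀ S, d < #S → a S = 0)
    (T : Finset α) {S : Finset α} (hS : d < #S + #T) : derivCoeff a T S = 0 := by
  unfold derivCoeff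
  split_ifs with h
  · exact ha _ (by rwa [card_union_of_disjoint h])
  · rfl

variable [Fintype α]

theorem sum_filter_subset_eq (T : Finset α) (φ : Finset α → Finset α → ℝ) :
    ∑ S with T ⊆ S, φ (S \ T) S = ∑ S with Disjoint S T, φ S (S ∪ T) := by
  refine sum_bij' (fun S _ => S \ T) (fun S _ => S ∪ T) ?_ ?_ ?_ ?_ ?_
  · intro S _; simpa using sdiff_disjoint
  · intro S _; simp
  · intro S hS
    simp only [mem_filter, mem_univ, true_and] at hS
    exact sdiff_union_of_subset hS
  · intro S hS
    simp only [mem_filter, mem_univ, true_and] at hS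
    rw [union_sdiff_right, sdiff_eq_self_of_disjoint hS]
  · intro S hS
    simp only [mem_filter, mem_univ, true_and] at hS
    rw [sdiff_union_of_subset hS]

theorem multiaffine_derivCoeff (a : Finset α → ℝ) (T : Finset α) (z : α → ℝ) :
    multiaffine (derivCoeff a T) z = ∑ S with T ⊆ S, a S * ∏ i ∈ S \ T, z i := by
  rw [sum_filter_subset_eq T (fun S' S => a S * ∏ i ∈ S', z i), sum_filter]
  refine sum_congr rfl fun S _ => ?_
  unfold derivCoeff
  split_ifs <;> simp

theorem multiaffine_add (a : Finset α → ℝ) (z w : α → ℝ) :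
    multiaffine a (z + w) = ∑ T, multiaffine (derivCoeff a T) z * ∏ i ∈ T, w i := by
  simp_rw [multiaffine_derivCoeff, sum_mul, sum_filter]
  rw [sum_comm]
  refine sum_congr rfl fun S _ => ?_
  have : ∏ i ∈ S, (z + w) i = ∑ T ∈ S.powerset, (∏ i ∈ T, w i) * ∏ i ∈ S \ T, z i := by
    simp_rw [Pi.add_apply, add_comm (z _)]
    exact prod_add _ _ _
  rw [this, mul_sum, ← sum_filter]
  refine sum_congr (by ext; simp) fun T _ => by ring

theorem multiaffine_derivCoeff_zero (a : Finset α → ℝ) (T : Finset α) :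
    multiaffine (derivCoeff a T) 0 = a T := by
  simp [multiaffine_zero, derivCoeff]

end Derivatives

section Markov

open Polynomial

theorem eval_iterate_derivative_T_one_le (d k : ℕ) :
    (derivative^[k] (Chebyshev.T ℝ d)).eval 1 ≤ (d : ℝ) ^ (2 * k) := by
  induction k with
  | zero => simp
  | succ k ih =>
    have h := Chebyshev.iterate_derivative_T_eval_one_recurrence (R := ℝ) d k
    rcases lt_or_ge d k with hdk | hdk
    · rw [iterate_derivative_eq_zero_of_degree_lt]
      · simp only [eval_zero]; positivity
      · rw [Chebyshev.degree_T]
        simp only [Int.natAbs_natCast]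
        exact_mod_cast Nat.lt_succ_of_lt hdk
    have h0 : (0 : ℝ) ≤ (d : ℝ) ^ 2 - k ^ 2 := by
      have : (k : ℝ) ≤ d := by exact_mod_cast hdk
      nlinarith [Nat.cast_nonneg (α := ℝ) k]
    push_cast at h
    have h1 : ((d : ℝ) ^ 2 - k ^ 2) * (derivative^[k] (Chebyshev.T ℝ d)).eval 1 ≤
        ((d : ℝ) ^ 2 - k ^ 2) * (d : ℝ) ^ (2 * k) := mul_le_mul_of_nonneg_left ih h0
    have h2 : ((d : ℝ) ^ 2 - k ^ 2) * (d : ℝ) ^ (2 * k) ≤ (d : ℝ) ^ (2 * (k + 1)) := by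
      have : (d : ℝ) ^ (2 * (k + 1)) = (d : ℝ) ^ 2 * (d : ℝ) ^ (2 * k) := by ring
      rw [this]
      exact mul_le_mul_of_nonneg_right (by nlinarith) (by positivity)
    have h3 : (2 * k + 1 : ℝ) * (derivative^[k + 1] (Chebyshev.T ℝ d)).eval 1 ≤
        (2 * k + 1) * (d : ℝ) ^ (2 * (k + 1)) := by
      rw [h]
      refine (h1.trans h2).trans (le_mul_of_one_le_left (by positivity) ?_)
      have := Nat.cast_nonneg (α := ℝ) k
      linarith
    exact le_of_mul_le_mul_left h3 (by positivity)

/-- A Markov-type bound for the coefficients of a polynomial bounded on `[-2, 0]`. -/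
theorem abs_coeff_le_of_bounded {d : ℕ} (p : ℝ[X]) (hp : p.degree ≤ d) {B : ℝ} (hB : 0 < B)
    (hbd : ∀ t ∈ Set.Icc (-2 : ℝ) 0, |p.eval t| ≤ B) (k : ℕ) :
    |p.coeff k| ≤ (d : ℝ) ^ (2 * k) * B := by
  have main : ∀ q : ℝ[X], q.degree ≤ d → (∀ t ∈ Set.Icc (-2 : ℝ) 0, |q.eval t| ≤ 1) →
      q.coeff k ≤ (d : ℝ) ^ (2 * k) := by
    intro q hq hqb
    have h1 := Chebyshev.eval_iterate_derivative_le_of_forall_abs_le_one (n := d) (k := k)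
      (P := taylor (-1) q) le_rfl (by rwa [degree_taylor]) (by
        intro x hx
        rw [taylor_eval]
        exact hqb _ ⟨by linarith [hx.1], by linarith [hx.2]⟩)
    have h2 : (derivative^[k] (taylor (-1) q)).eval 1 = k.factorial * q.coeff k := by
      rw [← factorial_smul_hasseDeriv, LinearMap.smul_apply, eval_smul, nsmul_eq_mul,
        ← taylor_coeff, taylor_taylor]
      simp
    rw [h2] at h1
    have h3 := h1.trans (eval_iterate_derivative_T_one_le d k)
    rcases le_or_gt (q.coeff k) 0 with h | h
    · exact h.trans (by positivity)
    · refine le_trans (le_mul_of_one_le_left h.le ?_) h3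
      exact_mod_cast Nat.factorial_pos k
  have hscale : ∀ c : ℝ, |c| ≤ 1 → c / B * p.coeff k ≤ (d : ℝ) ^ (2 * k) := by
    intro c hc
    have hdeg : (C (c / B) * p).degree ≤ d :=
      (smul_eq_C_mul (p := p) (c / B) ▸ degree_smul_le _ _).trans hp
    have := main (C (c / B) * p) hdeg (by
      intro t ht
      rw [eval_mul, eval_C, abs_mul, abs_div, abs_of_pos hB, div_mul_eq_mul_div, div_le_one hB]
      exact (mul_le_of_le_one_left (abs_nonneg _) hc).trans (hbd t ht))
    rwa [coeff_C_mul] at this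
  have h1 := hscale 1 (by simp)
  have h2 := hscale (-1) (by simp)
  rw [div_mul_eq_mul_div, div_le_iff₀ hB] at h1 h2
  exact abs_le.mpr ⟨by linarith, by linarith⟩

end Markov

section Boundedness

variable {α : Type*} [DecidableEq α] [Fintype α]

/-- The coefficients `a` define a polynomial of degree at most `d` bounded by `B` on the cube
`[-1, 1]^α`. -/
def IsBoundedPoly (d : ℕ) (B : ℝ) (a : Finset α → ℝ) : Prop :=
  (∀ S, d < #S → a S = 0) ∧ ∀ z : α → ℝ, (∀ i, |z i| ≤ 1) → |multiaffine a z| ≤ B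

/-- The coefficients of the `k`-homogeneous part of a multi-affine polynomial at `z`. -/
noncomputable def homogCoeff (a : Finset α → ℝ) (k : ℕ) (z : α → ℝ) (T : Finset α) : ℝ :=
  if #T = k then multiaffine (derivCoeff a T) z else 0

theorem isBoundedPoly_homogCoeff {d : ℕ} (hd : 1 ≤ d) {B : ℝ} (hB : 0 < B) {a : Finset α → ℝ}
    (ha : IsBoundedPoly d B a) (k : ℕ) {z : α → ℝ} (hz : ∀ i, |z i| ≤ 1 - 1 / (2 * d)) :
    IsBoundedPoly k ((4 * d ^ 3) ^ k * B) (homogCoeff a k z) := by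
  have hd0 : (0 : ℝ) < d := by exact_mod_cast hd
  refine ⟨fun S hS => if_neg hS.ne', fun y hy => ?_⟩
  set w : α → ℝ := (1 / (4 * d) : ℝ) • y with hw
  set p : Polynomial ℝ := ∑ T : Finset α,
    Polynomial.C (multiaffine (derivCoeff a T) z * ∏ i ∈ T, w i) * Polynomial.X ^ #T with hp
  have heval : ∀ t, p.eval t = multiaffine a (z + t • w) := by
    intro t
    rw [multiaffine_add, hp, Polynomial.eval_finsetSum]
    refine sum_congr rfl fun T _ => ?_
    simp only [Polynomial.eval_mul, Polynomial.eval_C, Polynomial.eval_pow, Polynomial.eval_X,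
      Pi.smul_apply, smul_eq_mul, prod_mul_distrib, prod_const]
    ring
  have hdeg : p.degree ≤ d := by
    refine (Polynomial.degree_sum_le _ _).trans (Finset.sup_le fun T _ => ?_)
    by_cases hT : d < #T
    · have : multiaffine (derivCoeff a T) z = 0 := by
        refine sum_eq_zero fun S _ => ?_
        rw [derivCoeff_eq_zero ha.1 T (by omega), zero_mul]
      simp [this]
    · exact (Polynomial.degree_C_mul_X_pow_le _ _).trans (by exact_mod_cast not_lt.mp hT)
  have hcoeff : p.coeff k = (1 / (4 * d)) ^ k * multiaffine (homogCoeff a k z) y := by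
    rw [hp, Polynomial.finsetSum_coeff, multiaffine, mul_sum]
    refine sum_congr rfl fun T _ => ?_
    rw [Polynomial.coeff_C_mul_X_pow, homogCoeff]
    by_cases hT : #T = k
    · rw [if_pos hT.symm, if_pos hT]
      simp only [hw, Pi.smul_apply, smul_eq_mul, prod_mul_distrib, prod_const, hT]
      ring
    · rw [if_neg (Ne.symm hT), if_neg hT]; simp
  have hbd : ∀ t ∈ Set.Icc (-2 : ℝ) 0, |p.eval t| ≤ B := by
    intro t ht
    rw [heval]
    refine ha.2 _ fun i => ?_
    have h1 : |t| ≤ 2 := abs_le.mpr ⟨ht.1, by linarith [ht.2]⟩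
    calc |(z + t • w) i| ≤ |z i| + |t * (1 / (4 * d) * y i)| := by
          simpa [hw] using abs_add_le (z i) (t * (1 / (4 * d) * y i))
      _ ≤ (1 - 1 / (2 * d)) + 2 * (1 / (4 * d) * 1) := by
          refine add_le_add (hz i) ?_
          rw [abs_mul, abs_mul, abs_of_pos (show (0 : ℝ) < 1 / (4 * d) by positivity)]
          gcongr
          exact hy i
      _ = 1 := by field_simp; ring
  have h := abs_coeff_le_of_bounded p hdeg hB hbd k
  rw [hcoeff, abs_mul, abs_of_pos (by positivity : (0 : ℝ) < (1 / (4 * d)) ^ k)] at h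
  have e : (4 * (d : ℝ) ^ 3) ^ k = (4 * d) ^ k * (d : ℝ) ^ (2 * k) := by
    rw [pow_mul, ← mul_pow]; ring
  rw [e, mul_assoc]
  refine le_of_mul_le_mul_left ?_ (by positivity : (0 : ℝ) < (1 / (4 * d)) ^ k)
  rw [← mul_assoc, ← mul_pow, one_div_mul_cancel (by positivity), one_pow, one_mul]
  exact h

theorem sum_abs_derivative_le {d : ℕ} (hd : 1 ≤ d) {B : ℝ} (hB : 0 < B) {a : Finset α → ℝ}
    (ha : IsBoundedPoly d B a) {z : α → ℝ} (hz : ∀ i, |z i| ≤ 1 - 1 / (2 * d)) :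
    ∑ T ∈ powersetCard 1 univ, |multiaffine (derivCoeff a T) z| ≤ 4 * d ^ 3 * B := by
  set y : α → ℝ := fun i => SignType.sign (multiaffine (derivCoeff a {i}) z) with hy
  have hy1 : ∀ i, |y i| ≤ 1 := by
    intro i
    simp only [hy]
    rcases lt_trichotomy (multiaffine (derivCoeff a {i}) z) 0 with h | h | h <;> simp [h]
  have h := (isBoundedPoly_homogCoeff hd hB ha 1 hz).2 y hy1
  rw [pow_one] at h
  refine le_trans (le_of_eq ?_) ((le_abs_self _).trans h)
  unfold multiaffine homogCoeff
  simp_rw [ite_mul, zero_mul]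
  rw [← sum_filter, powersetCard_one, sum_map]
  have : (univ.filter fun S : Finset α => #S = 1) =
      univ.map ⟨_, singleton_injective⟩ := by
    rw [← powersetCard_one]; ext; simp
  rw [this, sum_map]
  refine sum_congr rfl fun i _ => ?_
  simp only [Function.Embedding.coeFn_mk, prod_singleton, hy]
  exact (self_mul_sign _).symm

end Boundedness

section Levels

theorem half_le_pow {d j : ℕ} (hd : 1 ≤ d) (hj : j ≤ d) :
    (1 / 2 : ℝ) ≤ (1 - 1 / (2 * d)) ^ j := by
  have hd0 : (1 : ℝ) ≤ d := by exact_mod_cast hd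
  have h1 : (1 / (2 * d) : ℝ) ≤ 1 / 2 := by
    apply one_div_le_one_div_of_le <;> linarith
  have h2 : (0 : ℝ) ≤ 1 / (2 * d) := by positivity
  calc (1 / 2 : ℝ) = 1 + d * (-(1 / (2 * d))) := by field_simp; norm_num
    _ ≤ (1 + -(1 / (2 * d))) ^ d := one_add_mul_le_pow (by linarith) d
    _ ≤ (1 + -(1 / (2 * d))) ^ j := pow_le_pow_of_le_one (by linarith) (by linarith) hj
    _ = _ := by rw [← sub_eq_add_neg]

theorem abs_smul_cubeSign {α : Type*} {d : ℕ} (hd : 1 ≤ d) (x : α → Bool)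
    (i : α) :
    |((1 - 1 / (2 * d) : ℝ) • cubeSign x) i| ≤ 1 - 1 / (2 * d) := by
  have h := half_le_pow hd hd
  have h1 := half_le_pow (j := 1) hd hd
  rw [Pi.smul_apply, smul_eq_mul, abs_mul, abs_cubeSign, mul_one, abs_of_nonneg (by linarith)]

variable {α : Type*} [Fintype α]

/-- The square of the `ℓ^p` norm of the coefficients of size `m`, for `p = 2m / (m + 1)`. -/
noncomputable def levelNorm (a : Finset α → ℝ) (m : ℕ) : ℝ :=
  (∑ S ∈ powersetCard m univ, (a S ^ 2) ^ (m / (m + 1) : ℝ)) ^ ((m + 1) / m : ℝ)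

theorem sum_sq_rpow_le_of_levelNorm_le {d m : ℕ} (hmd : m ≤ d) {Z : ℝ} (hZ : 0 < Z)
    {a : Finset α → ℝ} (h0 : |a ∅| ≤ Z) (hm : 1 ≤ m → levelNorm a m ≤ Z ^ 2) :
    ∑ S ∈ powersetCard m univ, (a S ^ 2) ^ (d / (d + 1) : ℝ) ≤ (Z ^ 2) ^ (d / (d + 1) : ℝ) := by
  rcases Nat.eq_zero_or_pos m with rfl | hm1
  · rw [powersetCard_zero, sum_singleton, ← sq_abs]
    gcongr
  have hm0 : (0 : ℝ) < m := by exact_mod_cast hm1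
  have hmd' : (m : ℝ) ≤ d := by exact_mod_cast hmd
  set q : ℝ := m / (m + 1) with hq
  have hq0 : 0 < q := by positivity
  have hqd : q ≤ d / (d + 1) := by
    rw [hq, div_le_div_iff₀ (by positivity) (by positivity)]; nlinarith
  have hsum : ∑ S ∈ powersetCard m univ, (a S ^ 2 / Z ^ 2) ^ q ≤ 1 := by
    have h := Real.rpow_le_rpow (Real.rpow_nonneg (sum_nonneg fun S _ =>
      Real.rpow_nonneg (sq_nonneg (a S)) _) _) (hm hm1) (by positivity : (0 : ℝ) ≤ q)
    rw [← Real.rpow_mul (sum_nonneg fun S _ => Real.rpow_nonneg (sq_nonneg (a S)) _), hq,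
      div_mul_div_cancel₀ hm0.ne', div_self (by positivity), Real.rpow_one, ← hq] at h
    simp_rw [Real.div_rpow (sq_nonneg _) (sq_nonneg _)]
    rw [← sum_div]
    exact (div_le_one (by positivity)).mpr h
  have hle : ∀ S ∈ powersetCard m (univ : Finset α), a S ^ 2 / Z ^ 2 ≤ 1 := by
    intro S hS
    have h := (single_le_sum (f := fun S => (a S ^ 2 / Z ^ 2) ^ q)
      (fun S _ => by positivity) hS).trans hsum
    by_contra hlt
    exact absurd h (not_le.mpr (Real.one_lt_rpow (not_le.mp hlt) (by positivity)))
  have key : ∑ S ∈ powersetCard m univ, (a S ^ 2 / Z ^ 2) ^ (d / (d + 1) : ℝ) ≤ 1 := by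
    refine (sum_le_sum fun S hS => ?_).trans hsum
    exact Real.rpow_le_rpow_of_exponent_ge_of_imp (by positivity) (hle S hS) hqd
      fun _ h => absurd h (hq0.trans_le hqd).ne'
  simp_rw [Real.div_rpow (sq_nonneg _) (sq_nonneg _)] at key
  rwa [← sum_div, div_le_one (by positivity)] at key

theorem rpow_sum_le_of_levelNorm_le {d : ℕ} (hd : 1 ≤ d) {Z : ℝ} (hZ : 0 < Z)
    {a : Finset α → ℝ} (h0 : |a ∅| ≤ Z) (hm : ∀ m, 1 ≤ m → levelNorm a m ≤ Z ^ 2) :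
    (∑ S with #S ≤ d, |a S| ^ ((2 * d : ℝ) / (d + 1))) ^ ((d + 1 : ℝ) / (2 * d)) ≤
      (d + 1) * Z := by
  have hd0 : (1 : ℝ) ≤ d := by exact_mod_cast hd
  have hconv : ∀ c : ℝ, |c| ^ ((2 * d : ℝ) / (d + 1)) = (c ^ 2) ^ (d / (d + 1) : ℝ) := by
    intro c
    rw [← sq_abs c, ← Real.rpow_natCast, ← Real.rpow_mul (abs_nonneg c), mul_div_assoc]
    norm_num
  have hsum : ∑ S with #S ≤ d, |a S| ^ ((2 * d : ℝ) / (d + 1)) ≤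
      (d + 1) * Z ^ ((2 * d : ℝ) / (d + 1)) := by
    have hZ' := hconv Z
    rw [abs_of_pos hZ] at hZ'
    rw [hZ', sum_congr rfl fun S _ => hconv (a S)]
    have hfib : ∀ S ∈ univ.filter (fun S : Finset α => #S ≤ d), #S ∈ range (d + 1) := by
      intro S hS
      simpa [Nat.lt_succ_iff] using hS
    rw [← sum_fiberwise_of_maps_to hfib]
    have : ((d : ℝ) + 1) * (Z ^ 2) ^ (d / (d + 1) : ℝ) =
        ∑ m ∈ range (d + 1), (Z ^ 2) ^ (d / (d + 1) : ℝ) := by simp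
    rw [this]
    refine sum_le_sum fun m hmd => ?_
    have hmd' : m ≤ d := Nat.lt_succ_iff.mp (mem_range.mp hmd)
    refine le_trans (le_of_eq (sum_congr ?_ fun _ _ => rfl))
      (sum_sq_rpow_le_of_levelNorm_le hmd' hZ h0 (hm m))
    ext S
    simp only [mem_filter, mem_univ, true_and, mem_powersetCard_univ]
    omega
  refine (Real.rpow_le_rpow (sum_nonneg fun S _ => by positivity) hsum (by positivity)).trans ?_
  rw [Real.mul_rpow (by positivity) (by positivity), ← Real.rpow_mul hZ.le,
    div_mul_div_cancel₀ (by positivity), div_self (by positivity), Real.rpow_one]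
  gcongr
  refine Real.rpow_le_self_of_one_le (by linarith) ?_
  rw [div_le_one (by positivity)]
  linarith

variable [DecidableEq α]

theorem sum_sq_filter_subset_le {d : ℕ} (hd : 1 ≤ d) {a : Finset α → ℝ}
    (ha : ∀ S, d < #S → a S = 0) (m : ℕ) (T : Finset α) :
    ∑ S ∈ (powersetCard m univ).filter (T ⊆ ·), a S ^ 2 ≤ 4 * cubeMean fun x =>
      multiaffine (derivCoeff a T) ((1 - 1 / (2 * d) : ℝ) • cubeSign x) ^ 2 := by
  simp_rw [multiaffine_smul]
  rw [cubeMean_multiaffine_sq, mul_sum]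
  calc ∑ S ∈ (powersetCard m univ).filter (T ⊆ ·), a S ^ 2
      ≤ ∑ S with T ⊆ S, a S ^ 2 :=
        sum_le_sum_of_subset_of_nonneg (filter_subset_filter _ (subset_univ _))
          fun _ _ _ => sq_nonneg _
    _ = ∑ S, derivCoeff a T S ^ 2 := by
        rw [sum_filter_subset_eq T (fun _ S => a S ^ 2), sum_filter]
        refine sum_congr rfl fun S _ => ?_
        unfold derivCoeff
        split_ifs <;> simp
    _ ≤ _ := by
        refine sum_le_sum fun S _ => ?_
        by_cases hS : d < #S
        · rw [derivCoeff_eq_zero ha T (by omega)]; simp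
        · have h := half_le_pow hd (not_lt.mp hS)
          rw [mul_pow, ← mul_assoc]
          refine le_mul_of_one_le_left (sq_nonneg _) ?_
          nlinarith

theorem levelNorm_le_of_derivative {d k m : ℕ} (hd : 1 ≤ d) (hk : 1 ≤ k) (hkm : k ≤ m)
    {a : Finset α → ℝ} (ha : ∀ S, d < #S → a S = 0) {K : ℝ} (hK0 : 0 ≤ K)
    (hK : ∀ x : α → Bool, ∑ T ∈ powersetCard k univ,
      (multiaffine (derivCoeff a T) ((1 - 1 / (2 * d) : ℝ) • cubeSign x) ^ 2) ^
        (k / (k + 1) : ℝ) ≤ K) :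
    levelNorm a m ≤ 4 * 9 ^ (d / k : ℝ) * K ^ ((k + 1) / k : ℝ) := by
  have hk0 : (0 : ℝ) < k := by exact_mod_cast hk
  refine (blei k m hk hkm (fun S => a S ^ 2) fun _ => sq_nonneg _).trans ?_
  set q : ℝ := k / (k + 1) with hq
  have hq0 : 0 < q := by positivity
  set g : Finset α → (α → Bool) → ℝ := fun T x =>
    multiaffine (derivCoeff a T) ((1 - 1 / (2 * d) : ℝ) • cubeSign x) with hg
  have hT : ∀ T : Finset α, (∑ S ∈ (powersetCard m univ).filter (T ⊆ ·), a S ^ 2) ^ q ≤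
      4 ^ q * (9 ^ d) ^ (1 / (k + 1) : ℝ) * cubeMean fun x => (g T x ^ 2) ^ q := by
    intro T
    have h4 : (cubeMean fun x => g T x ^ 4) ≤ 9 ^ d * (cubeMean fun x => g T x ^ 2) ^ 2 := by
      simp only [hg, multiaffine_smul]
      refine cubeMean_multiaffine_pow_four_le d _ fun S hS => ?_
      rw [derivCoeff_eq_zero ha T (by omega), mul_zero]
    have h0 : 0 ≤ cubeMean fun x => g T x ^ 2 := cubeMean_nonneg fun _ => sq_nonneg _
    calc (∑ S ∈ (powersetCard m univ).filter (T ⊆ ·), a S ^ 2) ^ q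
        ≤ (4 * cubeMean fun x => g T x ^ 2) ^ q :=
          Real.rpow_le_rpow (sum_nonneg fun _ _ => sq_nonneg _)
            (sum_sq_filter_subset_le hd ha m T) hq0.le
      _ = 4 ^ q * (cubeMean fun x => g T x ^ 2) ^ q := Real.mul_rpow (by norm_num) h0
      _ ≤ 4 ^ q * ((9 ^ d) ^ (1 / (k + 1) : ℝ) * cubeMean fun x => (g T x ^ 2) ^ q) := by
          gcongr
          exact cubeMean_sq_rpow_le k hk (9 ^ d) (by positivity) (g T) h4
      _ = _ := by ring
  have hsum : ∑ T ∈ powersetCard k univ,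
      (∑ S ∈ (powersetCard m univ).filter (T ⊆ ·), a S ^ 2) ^ q ≤
      4 ^ q * (9 ^ d) ^ (1 / (k + 1) : ℝ) * K := by
    refine (sum_le_sum fun T _ => hT T).trans ?_
    rw [← mul_sum, ← cubeMean_sum]
    gcongr
    exact (cubeMean_mono hK).trans (cubeMean_const K).le
  refine (Real.rpow_le_rpow (sum_nonneg fun T _ => ?_) hsum (by positivity)).trans_eq ?_
  · exact Real.rpow_nonneg (sum_nonneg fun _ _ => sq_nonneg _) _
  · rw [Real.mul_rpow (by positivity) hK0, Real.mul_rpow (by positivity) (by positivity),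
      ← Real.rpow_mul (by norm_num), ← Real.rpow_mul (by positivity), ← Real.rpow_natCast,
      ← Real.rpow_mul (by norm_num)]
    congr 2
    · rw [hq, div_mul_div_cancel₀ (by positivity), div_self hk0.ne', Real.rpow_one]
    · congr 1
      field_simp

theorem IsBoundedPoly.levelNorm_le_nine_pow {d m : ℕ} (hd : 1 ≤ d) (hm : 1 ≤ m) {B : ℝ}
    (hB : 0 < B) {a : Finset α → ℝ} (ha : IsBoundedPoly d B a) :
    levelNorm a m ≤ (2 * 3 ^ d * (4 * d ^ 3 * B)) ^ 2 := by
  refine (levelNorm_le_of_derivative hd le_rfl hm ha.1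
    (by positivity : 0 ≤ 4 * (d : ℝ) ^ 3 * B) fun x => ?_).trans_eq ?_
  · refine le_trans (le_of_eq (sum_congr rfl fun T _ => ?_))
      (sum_abs_derivative_le hd hB ha (abs_smul_cubeSign hd x))
    rw [show ((1 : ℕ) / ((1 : ℕ) + 1) : ℝ) = 1 / 2 by norm_num, ← Real.sqrt_eq_rpow,
      Real.sqrt_sq_eq_abs]
  · rw [show (((1 : ℕ) + 1) / (1 : ℕ) : ℝ) = (2 : ℕ) by norm_num, Nat.cast_one, div_one,
      Real.rpow_natCast, Real.rpow_natCast, show (9 : ℝ) = 3 ^ 2 by norm_num, ← pow_mul]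
    ring

/-- The bound on the homogeneous part of size `k` of a shifted polynomial. -/
noncomputable def levelBound (d k : ℕ) (B : ℝ) : ℝ :=
  2 * 3 ^ k * (4 * k ^ 3 * ((4 * d ^ 3) ^ k * B))

theorem levelBound_pos {d k : ℕ} (hd : 1 ≤ d) (hk : 1 ≤ k) {B : ℝ} (hB : 0 < B) :
    0 < levelBound d k B := by
  have hd0 : (0 : ℝ) < d := by exact_mod_cast hd
  have hk0 : (0 : ℝ) < k := by exact_mod_cast hk
  unfold levelBound
  positivity

theorem levelBound_mono {d k m : ℕ} (hd : 1 ≤ d) (hmk : m ≤ k) {B : ℝ} (hB : 0 < B) :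
    levelBound d m B ≤ levelBound d k B := by
  have hd0 : (1 : ℝ) ≤ d := by exact_mod_cast hd
  have h1 : (1 : ℝ) ≤ 4 * d ^ 3 := by nlinarith [one_le_pow₀ hd0 (n := 3)]
  have h2 : (1 : ℝ) ≤ 3 := by norm_num
  unfold levelBound
  gcongr

theorem le_levelBound {d k : ℕ} (hd : 1 ≤ d) (hk : 1 ≤ k) {B : ℝ} (hB : 0 < B) :
    B ≤ levelBound d k B := by
  have hd0 : (1 : ℝ) ≤ d := by exact_mod_cast hd
  refine le_trans ?_ (levelBound_mono hd hk hB)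
  unfold levelBound
  have : 1 ≤ 24 * (4 * (d : ℝ) ^ 3) := by nlinarith [one_le_pow₀ hd0 (n := 3)]
  norm_num
  nlinarith

theorem IsBoundedPoly.levelNorm_homogCoeff_le {d k : ℕ} (hd : 1 ≤ d) (hk : 1 ≤ k) {B : ℝ}
    (hB : 0 < B) {a : Finset α → ℝ} (ha : IsBoundedPoly d B a) {z : α → ℝ}
    (hz : ∀ i, |z i| ≤ 1 - 1 / (2 * d)) :
    (∑ T ∈ powersetCard k univ,
      (multiaffine (derivCoeff a T) z ^ 2) ^ (k / (k + 1) : ℝ)) ^ ((k + 1) / k : ℝ) ≤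
      levelBound d k B ^ 2 := by
  have hd0 : (0 : ℝ) < d := by exact_mod_cast hd
  refine le_trans (le_of_eq ?_)
    ((isBoundedPoly_homogCoeff hd hB ha k hz).levelNorm_le_nine_pow hk hk (by positivity))
  unfold levelNorm
  congr 1
  refine sum_congr rfl fun T hT => ?_
  rw [homogCoeff, if_pos (mem_powersetCard_univ.mp hT)]

theorem IsBoundedPoly.levelNorm_le {d k m : ℕ} (hd : 1 ≤ d) (hk : 1 ≤ k) (hm : 1 ≤ m) {B : ℝ}
    (hB : 0 < B) {a : Finset α → ℝ} (ha : IsBoundedPoly d B a) :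
    levelNorm a m ≤ (2 * 3 ^ (d / k : ℝ) * levelBound d k B) ^ 2 := by
  have hk0 : (0 : ℝ) < k := by exact_mod_cast hk
  have hW := levelBound_pos hd hk hB
  rcases le_or_gt k m with hkm | hkm
  · refine (levelNorm_le_of_derivative hd hk hkm ha.1
      (K := (levelBound d k B ^ 2) ^ (k / (k + 1) : ℝ)) (by positivity) fun x => ?_).trans_eq ?_
    · have h := ha.levelNorm_homogCoeff_le hd hk hB (abs_smul_cubeSign hd x)
      set s := ∑ T ∈ powersetCard k univ, (multiaffine (derivCoeff a T)
        ((1 - 1 / (2 * d) : ℝ) • cubeSign x) ^ 2) ^ (k / (k + 1) : ℝ) with hs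
      have hs0 : 0 ≤ s := sum_nonneg fun T _ => by positivity
      have h' := Real.rpow_le_rpow (by positivity) h
        (by positivity : (0 : ℝ) ≤ k / (k + 1))
      rwa [← Real.rpow_mul hs0, div_mul_div_cancel₀ hk0.ne', div_self (by positivity),
        Real.rpow_one] at h'
    · rw [← Real.rpow_mul (by positivity), div_mul_div_cancel₀ (by positivity),
        div_self hk0.ne', Real.rpow_one, mul_pow, mul_pow, ← Real.rpow_mul_natCast (by norm_num),
        mul_comm (d / k : ℝ), Real.rpow_mul (by norm_num)]
      norm_num
  · have h1 := half_le_pow (j := 1) hd hd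
    have h := ha.levelNorm_homogCoeff_le hd hm hB (z := 0) (by intro i; simp at h1 ⊢; linarith)
    simp only [multiaffine_derivCoeff_zero] at h
    refine h.trans ?_
    have h3 : (1 : ℝ) ≤ 3 ^ (d / k : ℝ) := Real.one_le_rpow (by norm_num) (by positivity)
    have hW' := (levelBound_pos hd hm hB).le
    gcongr
    refine (levelBound_mono hd hkm.le hB).trans ?_
    nlinarith

end Levels

section Constant

theorem exists_levelBound_le {d : ℕ} (hd : 2 ≤ d) {B : ℝ} (hB : 0 < B) :
    ∃ k : ℕ, 1 ≤ k ∧ (d + 1) * (2 * 3 ^ (d / k : ℝ) * levelBound d k B) ≤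
      Real.exp 34 ^ Real.sqrt (d * Real.log d) * B := by
  have hd2 : (2 : ℝ) ≤ d := by exact_mod_cast hd
  set L := Real.log d with hL
  set s := Real.sqrt (d * L) with hs
  have hL2 : 0.6931471803 < L :=
    Real.log_two_gt_d9.trans_le (Real.log_le_log (by norm_num) hd2)
  have hLd : L ≤ d := (Real.log_le_sub_one_of_pos (by linarith)).trans (by linarith)
  have hs1 : 1 ≤ s := Real.one_le_sqrt.mpr (by nlinarith)
  have hss : s * s = d * L := Real.mul_self_sqrt (by nlinarith)
  have hs0 : 0 < s := by linarith
  have hLs : L ≤ s := Real.le_sqrt_of_sq_le (by nlinarith)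
  set k := ⌈d / s⌉₊ with hk
  have hk1 : 1 ≤ k := Nat.one_le_ceil_iff.mpr (by positivity)
  have hk1' : (1 : ℝ) ≤ k := by exact_mod_cast hk1
  have hks : d / s ≤ (k : ℝ) := Nat.le_ceil _
  have hkd : (k : ℝ) ≤ d := by
    have : k ≤ d := Nat.ceil_le.mpr (div_le_self (by linarith) hs1)
    exact_mod_cast this
  have hkL : k * L ≤ 2 * s := by
    have h1 : (k : ℝ) ≤ d / s + 1 := (Nat.ceil_lt_add_one (by positivity)).le
    have h2 : d / s * L = s := by rw [div_mul_eq_mul_div, ← hss, mul_div_assoc, div_self hs0.ne',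
      mul_one]
    nlinarith
  have hdk : d / k ≤ s := by
    rw [div_le_iff₀ hs0] at hks
    rw [div_le_iff₀ (by linarith)]
    linarith
  refine ⟨k, hk1, ?_⟩
  have h3 : (3 : ℝ) ^ (d / k : ℝ) ≤ Real.exp (2 * s) := by
    refine (Real.rpow_le_rpow_of_exponent_le (by norm_num) hdk).trans ?_
    rw [Real.exp_mul]
    refine Real.rpow_le_rpow (by norm_num) ?_ hs0.le
    linarith [Real.add_one_le_exp (2 : ℝ)]
  have hpow : (d + 1) * 16 * 3 ^ k * k ^ 3 * (4 * d ^ 3) ^ k ≤ (d : ℝ) ^ (16 * k) := by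
    have e1 : (d : ℝ) + 1 ≤ d ^ 2 := by nlinarith
    have e2 : (16 : ℝ) ≤ d ^ 4 := by
      calc (16 : ℝ) = 2 ^ 4 := by norm_num
        _ ≤ d ^ 4 := by gcongr
    have e3 : (3 : ℝ) ≤ d ^ 2 := by nlinarith
    have e4 : 4 * (d : ℝ) ^ 3 ≤ d ^ 5 := by
      have : (d : ℝ) ^ 5 = d ^ 2 * d ^ 3 := by ring
      rw [this]
      gcongr
      nlinarith
    calc (d + 1) * 16 * 3 ^ k * k ^ 3 * (4 * d ^ 3) ^ k
        ≤ (d : ℝ) ^ 2 * d ^ 4 * (d ^ 2) ^ k * d ^ 3 * (d ^ 5) ^ k := by gcongr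
      _ = (d : ℝ) ^ (9 + 7 * k) := by rw [← pow_mul, ← pow_mul]; ring
      _ ≤ (d : ℝ) ^ (16 * k) := pow_le_pow_right₀ (by linarith) (by omega)
  have hexp : (d : ℝ) ^ (16 * k) ≤ Real.exp (32 * s) := by
    rw [← Real.rpow_natCast, Real.rpow_def_of_pos (by linarith)]
    refine Real.exp_le_exp.mpr ?_
    push_cast
    linarith
  calc (d + 1) * (2 * 3 ^ (d / k : ℝ) * levelBound d k B)
      = ((d + 1) * 16 * 3 ^ k * k ^ 3 * (4 * d ^ 3) ^ k) * 3 ^ (d / k : ℝ) * B := by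
        unfold levelBound; ring
    _ ≤ Real.exp (32 * s) * Real.exp (2 * s) * B := by
        have := hpow.trans hexp
        gcongr
    _ = Real.exp 34 ^ s * B := by
        rw [← Real.exp_add, ← Real.exp_mul]
        ring_nf

end Constant

section Cube

theorem IsBoundedPoly.mono {α : Type*} [Fintype α] {d : ℕ} {B B' : ℝ} {a : Finset α → ℝ}
    (ha : IsBoundedPoly d B a) (h : B ≤ B') : IsBoundedPoly d B' a :=
  ⟨ha.1, fun z hz => (ha.2 z hz).trans h⟩

theorem IsBoundedPoly.sum_abs_le {α : Type*} [Fintype α] {B : ℝ} {a : Finset α → ℝ}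
    (ha : IsBoundedPoly 1 B a) : ∑ S with #S ≤ 1, |a S| ≤ B := by
  set ε : ℝ := if 0 ≤ a ∅ then 1 else -1 with hε
  have hε1 : |ε| = 1 := by rw [hε]; split_ifs <;> simp
  set z : α → ℝ := fun i => ε * SignType.sign (a {i}) with hz
  have hz1 : ∀ i, |z i| ≤ 1 := by
    intro i
    simp only [hz, abs_mul, hε1, one_mul]
    rcases lt_trichotomy (a {i}) 0 with h | h | h <;> simp [h]
  have hterm : ∀ S : Finset α, #S ≤ 1 → a S * ∏ i ∈ S, z i = ε * |a S| := by
    intro S hS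
    rcases Nat.le_one_iff_eq_zero_or_eq_one.mp hS with h | h
    · rw [card_eq_zero.mp h, prod_empty, mul_one, hε]
      split_ifs with h0
      · rw [abs_of_nonneg h0, one_mul]
      · rw [abs_of_neg (not_le.mp h0)]; ring
    · obtain ⟨i, rfl⟩ := card_eq_one.mp h
      rw [prod_singleton, ← self_mul_sign]
      simp only [hz]
      ring
  have hsum : multiaffine a z = ε * ∑ S with #S ≤ 1, |a S| := by
    rw [multiaffine, mul_sum, sum_filter]
    refine sum_congr rfl fun S _ => ?_
    split_ifs with h
    · exact hterm S h
    · rw [ha.1 S (not_le.mp h), zero_mul]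
  have h := ha.2 z hz1
  rw [hsum, abs_mul, hε1, one_mul] at h
  exact (le_abs_self _).trans h

variable {n : ℕ}

theorem abs_le_supNorm (f : (Fin n → Bool) → ℝ) (x : Fin n → Bool) : |f x| ≤ supNorm f :=
  le_ciSup (f := fun x => |f x|) (Set.finite_range _).bddAbove x

theorem multiaffine_walshCoeff (f : (Fin n → Bool) → ℝ) (z : Fin n → ℝ) :
    multiaffine (walshCoeff f) z = (∑ x, f x * ∏ i, (1 + cubeSign x i * z i)) / 2 ^ n := by
  have h : ∀ x : Fin n → Bool, ∏ i, (1 + cubeSign x i * z i) =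
      ∑ S : Finset (Fin n), walsh S x * ∏ i ∈ S, z i := by
    intro x
    rw [prod_one_add, powerset_univ]
    exact sum_congr rfl fun S _ => prod_mul_distrib
  simp_rw [h, multiaffine, walshCoeff, mul_sum, div_mul_eq_mul_div, ← sum_div, sum_mul]
  rw [sum_comm]
  simp_rw [mul_assoc]

theorem sum_prod_one_add_cubeSign_mul (z : Fin n → ℝ) :
    ∑ x : Fin n → Bool, ∏ i, (1 + cubeSign x i * z i) = 2 ^ n := by
  have h := prod_univ_sum (fun _ : Fin n => (univ : Finset Bool))
    (fun i b => 1 + (if b = true then (1 : ℝ) else -1) * z i)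
  rw [Fintype.piFinset_univ] at h
  unfold cubeSign
  rw [← h]
  have h2 : ∀ i, ∑ b : Bool, (1 + (if b = true then (1 : ℝ) else -1) * z i) = 2 := by
    intro i
    rw [Fintype.sum_bool]
    norm_num
    ring
  simp_rw [h2]
  simp

theorem isBoundedPoly_walshCoeff {d : ℕ} (f : (Fin n → Bool) → ℝ)
    (hf : ∀ S : Finset (Fin n), d < #S → walshCoeff f S = 0) :
    IsBoundedPoly d (supNorm f) (walshCoeff f) := by
  refine ⟨hf, fun z hz => ?_⟩
  have hpos : ∀ x : Fin n → Bool, 0 ≤ ∏ i, (1 + cubeSign x i * z i) := by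
    intro x
    refine prod_nonneg fun i _ => ?_
    have h : |cubeSign x i * z i| ≤ 1 := by rw [abs_mul, abs_cubeSign, one_mul]; exact hz i
    linarith [(abs_le.mp h).1]
  rw [multiaffine_walshCoeff, abs_div, abs_of_pos (by positivity : (0 : ℝ) < 2 ^ n),
    div_le_iff₀ (by positivity), ← sum_prod_one_add_cubeSign_mul z, mul_sum]
  refine (abs_sum_le_sum_abs _ _).trans (sum_le_sum fun x _ => ?_)
  rw [abs_mul, abs_of_nonneg (hpos x)]
  exact mul_le_mul_of_nonneg_right (abs_le_supNorm f x) (hpos x)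

end Cube

theorem IsBoundedPoly.rpow_sum_le {α : Type*} [DecidableEq α] [Fintype α] {d : ℕ} (hd : 1 ≤ d)
    {B : ℝ} (hB : 0 < B) {a : Finset α → ℝ} (ha : IsBoundedPoly d B a) :
    (∑ S with #S ≤ d, |a S| ^ ((2 * d : ℝ) / (d + 1))) ^ ((d + 1 : ℝ) / (2 * d)) ≤
      Real.exp 34 ^ Real.sqrt (d * Real.log d) * B := by
  rcases hd.eq_or_lt with rfl | hd2
  · have h := ha.sum_abs_le
    norm_num
    exact h
  obtain ⟨k, hk, hle⟩ := exists_levelBound_le hd2 hB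
  have hW := levelBound_pos hd hk hB
  have h3 : (1 : ℝ) ≤ 3 ^ (d / k : ℝ) := Real.one_le_rpow (by norm_num) (by positivity)
  refine (rpow_sum_le_of_levelNorm_le hd (by positivity) ?_
    fun m hm => ha.levelNorm_le hd hk hm hB).trans hle
  have h0 := ha.2 0 (by simp)
  rw [multiaffine_zero] at h0
  nlinarith [le_levelBound hd hk hB]

/-- Bohnenblust–Hille inequality for functions of degree at most `d` on the Boolean cube,
with subexponential constant `C^{√(d log d)}`. -/
theorem bh_boolean_degree_d :
    ∃ C > (0 : ℝ), ∀ (d n : ℕ), 1 ≤ d → ∀ f : (Fin n → Bool) → ℝ,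
      (∀ S : Finset (Fin n), d < S.card → walshCoeff f S = 0) →
      (∑ S ∈ Finset.univ.filter (fun S : Finset (Fin n) => S.card ≤ d),
          |walshCoeff f S| ^ ((2 * d : ℝ) / (d + 1))) ^ ((d + 1 : ℝ) / (2 * d))
        ≤ C ^ Real.sqrt (d * Real.log d) * supNorm f := by
  refine ⟨Real.exp 34, Real.exp_pos _, fun d n hd f hf => ?_⟩
  have ha := isBoundedPoly_walshCoeff f hf
  have hc : 0 < Real.exp 34 ^ Real.sqrt (d * Real.log d) := by positivity
  have hN : 0 ≤ supNorm f := (abs_nonneg _).trans (abs_le_supNorm f fun _ => true)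
  rw [← div_le_iff₀' hc]
  refine le_of_forall_gt_imp_ge_of_dense fun B hB => ?_
  rw [div_le_iff₀' hc]
  exact (ha.mono hB.le).rpow_sum_le hd (hN.trans_lt hB)
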